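/- arXiv:1712.04781 — 3 statements merged into one kernel-verified Lean document; each statement's English description precedes it below -/
import Mathlib

section
/- Let (𝒜, ℬ) be a complete hereditary cotorsion pair in a Grothendieck category G such that every object of ℬ has finite injective dimension. Then every acyclic unbounded cochain complex X all of whose components lie in 𝒜 has all of its cycle objects Z^j(X) in 𝒜; that is, ex𝒜 = 𝒜~. -/
open CategoryTheory CategoryTheory.Limits CategoryTheory.Abelian ZeroObject

universe w' w v u

/-- There is a short exact sequence `0 → X → Y → Z → 0` in the abelian category `C`. -/
def IsShortExactSeq {C : Type u} [Category.{v} C] [Abelian C] (X Y Z : C) : Prop :=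
  ∃ (f : X ⟶ Y) (g : Y ⟶ Z) (w : f ≫ g = 0), (ShortComplex.mk f g w).ShortExact

/-- `(𝒜, ℬ)` is a cotorsion pair in the abelian category `C`:
each class is the `Ext¹`-orthogonal of the other. -/
structure IsCotorsionPair (C : Type u) [Category.{v} C] [Abelian C] [HasExt.{w} C]
    (𝒜 ℬ : Set C) : Prop where
  mem_left_iff : ∀ X : C, X ∈ 𝒜 ↔ ∀ B ∈ ℬ, Subsingleton (Abelian.Ext.{w} X B 1)
  mem_right_iff : ∀ Y : C, Y ∈ ℬ ↔ ∀ A ∈ 𝒜, Subsingleton (Abelian.Ext.{w} A Y 1)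

/-- `(𝒜, ℬ)` is a complete cotorsion pair: every object has a special `ℬ`-preenvelope
`0 → M → B → A → 0` and a special `𝒜`-precover `0 → B' → A' → M → 0`. -/
structure IsCompleteCotorsionPair (C : Type u) [Category.{v} C] [Abelian C] [HasExt.{w} C]
    (𝒜 ℬ : Set C) extends IsCotorsionPair C 𝒜 ℬ : Prop where
  preenvelope : ∀ M : C, ∃ B A, B ∈ ℬ ∧ A ∈ 𝒜 ∧ IsShortExactSeq M B A
  precover : ∀ M : C, ∃ B A, B ∈ ℬ ∧ A ∈ 𝒜 ∧ IsShortExactSeq B A M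

/-- `(𝒜, ℬ)` is a complete hereditary cotorsion pair:
moreover `Ext^i(A, B) = 0` for all `A ∈ 𝒜`, `B ∈ ℬ` and `i ≥ 1`. -/
structure IsCompleteHereditaryCotorsionPair (C : Type u) [Category.{v} C] [Abelian C]
    [HasExt.{w} C] (𝒜 ℬ : Set C) extends IsCompleteCotorsionPair C 𝒜 ℬ : Prop where
  hereditary : ∀ A ∈ 𝒜, ∀ B ∈ ℬ, ∀ i : ℕ, 1 ≤ i → Subsingleton (Abelian.Ext.{w} A B i)

/-- In a complex which is exact at `i + 1`, there is a short exact sequence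
`0 → Zⁱ → Xⁱ → Zⁱ⁺¹ → 0`. -/
lemma shortExact_cycles_of_exactAt {C : Type u} [Category.{v} C] [Abelian C]
    (X : CochainComplex C ℤ) (i : ℤ) (h : X.ExactAt (i + 1)) :
    (ShortComplex.mk (X.iCycles i) (X.toCycles i (i + 1))
      (by simp [← cancel_mono (X.iCycles (i + 1))])).ShortExact where
  exact := by
    refine ShortComplex.exact_of_f_is_kernel _ (KernelFork.IsLimit.ofι' _ _ fun k hk => ?_)
    have hk' : k ≫ X.d i (i + 1) = 0 := by
      simpa using hk =≫ X.iCycles (i + 1)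
    exact ⟨X.liftCycles k (i + 1) (by simp) hk', by simp⟩
  mono_f := inferInstanceAs (Mono (X.iCycles i))
  epi_g := Preadditive.epi_of_isZero_cokernel' _
    (X.homologyIsCokernel i (i + 1) (by simp)) h.isZero_homology

/-- In a short exact sequence whose middle term is `Ext`-orthogonal to `B` in degree `i`,
vanishing of `Extⁱ⁺¹(-, B)` on the third term implies vanishing of `Extⁱ(-, B)` on the first. -/
lemma subsingleton_ext_of_shortExact {C : Type u} [Category.{v} C] [Abelian C] [HasExt.{w} C]
    {S : ShortComplex C} (hS : S.ShortExact) (B : C) (i : ℕ)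
    (h₂ : Subsingleton (Abelian.Ext.{w} S.X₂ B i))
    (h₃ : Subsingleton (Abelian.Ext.{w} S.X₃ B (1 + i))) :
    Subsingleton (Abelian.Ext.{w} S.X₁ B i) := by
  refine subsingleton_of_forall_eq 0 fun x => ?_
  obtain ⟨y, rfl⟩ := Ext.contravariant_sequence_exact₁ hS B x rfl (Subsingleton.elim _ _)
  rw [Subsingleton.elim y 0, Ext.comp_zero]

/-- if `(𝒜, ℬ)` is a complete hereditary cotorsion pair in a Grothendieck
category and every object of `ℬ` has finite injective dimension, then every acyclic
cochain complex with components in `𝒜` has all its cycle objects in `𝒜` (`ex𝒜 = 𝒜~`). -/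
theorem stmt4 (C : Type u) [Category.{v} C] [Abelian C]
    [HasFilteredColimits C] [AB5 C] [HasSeparator C]
    [HasExt.{w} C]
    (𝒜 ℬ : Set C) (hcp : IsCompleteHereditaryCotorsionPair C 𝒜 ℬ)
    -- every object of `ℬ` has finite injective dimension:
    (hfid : ∀ B ∈ ℬ, ∃ n : ℕ, ∀ (M : C) (i : ℕ), n < i → Subsingleton (Abelian.Ext.{w} M B i))
    (X : CochainComplex C ℤ)
    (hac : ∀ n : ℤ, X.ExactAt n) (hcomp : ∀ n : ℤ, X.X n ∈ 𝒜) :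
    ∀ j : ℤ, X.cycles j ∈ 𝒜 := by
  intro j
  rw [hcp.mem_left_iff]
  intro B hB
  obtain ⟨n, hn⟩ := hfid B hB
  have key : ∀ (k i : ℕ) (j : ℤ), 1 ≤ i → n < i + k →
      Subsingleton (Abelian.Ext.{w} (X.cycles j) B i) := by
    intro k
    induction k with
    | zero => exact fun i j _ hk => hn _ _ hk
    | succ k ih =>
      intro i j hi hk
      exact subsingleton_ext_of_shortExact (shortExact_cycles_of_exactAt X j (hac _)) B i
        (hcp.hereditary _ (hcomp j) B hB i hi) (ih (1 + i) (j + 1) (by lia) (by lia))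
  exact key n 1 j le_rfl (by lia)
end

section
/- Let R be a ring, let T be an n-tilting right R-module, and let ℬ = {M : Ext^i_R(T, M) = 0 for all i ≥ 1} be the associated n-tilting class. Then every acyclic unbounded cochain complex of right R-modules all of whose components lie in ℬ has all of its cycle modules in ℬ; that is, exℬ = ℬ~. -/
open CategoryTheory CategoryTheory.Limits CategoryTheory.Abelian ZeroObject

universe w' w v u

/-- `X` is a direct summand of a direct sum (coproduct) of copies of `T`, i.e. `X ∈ Add T`. -/
def IsAddMember {C : Type u} [Category.{v} C] (T X : C) : Prop :=
  ∃ (ι : Type v) (c : Cofan fun _ : ι => T) (_ : IsColimit c) (s : X ⟶ c.pt) (r : c.pt ⟶ X),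
    s ≫ r = 𝟙 X

/-- In a short exact sequence `0 → X₁ → X₂ → X₃ → 0`, the vanishing of `Ext^i(T, X₂)` and of
`Ext^{i+1}(T, X₁)` implies that of `Ext^i(T, X₃)`. -/
lemma CategoryTheory.ShortComplex.ShortExact.subsingleton_ext_X₃
    {C : Type u} [Category.{v} C] [Abelian C] [HasExt.{w} C] {S : ShortComplex C}
    (hS : S.ShortExact) (T : C) (i : ℕ) [Subsingleton (Abelian.Ext.{w} T S.X₂ i)]
    [Subsingleton (Abelian.Ext.{w} T S.X₁ (i + 1))] :
    Subsingleton (Abelian.Ext.{w} T S.X₃ i) := by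
  refine subsingleton_of_forall_eq 0 fun x => ?_
  obtain ⟨y, rfl⟩ := Ext.covariant_sequence_exact₃ T hS x rfl (Subsingleton.elim _ _)
  rw [Subsingleton.elim y 0, Ext.zero_comp]

/-- If a cochain complex `Y` is exact in degree `j = i + 1`, then
`0 → Z^i → Y^i → Z^j → 0` is a short exact sequence. -/
lemma CochainComplex.shortExact_cycles {C : Type u} [Category.{v} C] [Abelian C]
    (Y : CochainComplex C ℤ) (i j : ℤ) (hij : i + 1 = j) (hY : Y.ExactAt j) :
    (ShortComplex.mk (Y.iCycles i) (Y.toCycles i j) (by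
      rw [← cancel_mono (Y.iCycles j)]; simp)).ShortExact where
  exact := by
    let φ : ShortComplex.mk (Y.iCycles i) (Y.toCycles i j) (by
        rw [← cancel_mono (Y.iCycles j)]; simp) ⟶
        ShortComplex.mk (Y.iCycles i) (Y.d i j) (Y.iCycles_d i j) :=
      { τ₁ := 𝟙 _
        τ₂ := 𝟙 _
        τ₃ := Y.iCycles j }
    have : Epi φ.τ₁ := inferInstanceAs (Epi (𝟙 _))
    have : IsIso φ.τ₂ := inferInstanceAs (IsIso (𝟙 _))
    have : Mono φ.τ₃ := inferInstanceAs (Mono (Y.iCycles j))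
    exact (ShortComplex.exact_iff_of_epi_of_isIso_of_mono φ).2
      (ShortComplex.exact_of_f_is_kernel _ (Y.cyclesIsKernel i j (by simpa using hij)))
  mono_f := inferInstanceAs (Mono (Y.iCycles i))
  epi_g := by
    obtain rfl : (ComplexShape.up ℤ).prev j = i := by simp [← hij]
    exact ((Y.exactAt_iff j).1 hY).epi_toCycles

/-- Dimension shifting: if `Y` is an acyclic complex whose components have vanishing positive
`Ext^i(T, -)`, then the vanishing of `Ext^i(T, -)` for `i > n` forces all cycles of `Y` to have
vanishing positive `Ext^i(T, -)`. -/
lemma CochainComplex.subsingleton_ext_cycles {C : Type u} [Category.{v} C] [Abelian C]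
    [HasExt.{w} C] (T : C) (n : ℕ)
    (hT : ∀ (N : C) (i : ℕ), n < i → Subsingleton (Abelian.Ext.{w} T N i))
    (Y : CochainComplex C ℤ) (hY : ∀ m, Y.ExactAt m)
    (hX : ∀ (m : ℤ) (i : ℕ), 1 ≤ i → Subsingleton (Abelian.Ext.{w} T (Y.X m) i))
    (m : ℤ) (i : ℕ) (hi : 1 ≤ i) : Subsingleton (Abelian.Ext.{w} T (Y.cycles m) i) := by
  suffices h : ∀ (k : ℕ) (m : ℤ) (i : ℕ), 1 ≤ i → n < i + k →
      Subsingleton (Abelian.Ext.{w} T (Y.cycles m) i) from h n m i hi (by lia)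
  intro k
  induction k with
  | zero => exact fun m i _ h => hT _ i h
  | succ k ih =>
    intro m i hi h
    have := hX (m - 1) i hi
    have := ih (m - 1) (i + 1) (by lia) (by lia)
    exact (Y.shortExact_cycles (m - 1) m (by lia) (hY m)).subsingleton_ext_X₃ T i

/-- if `T` is an `n`-tilting right `R`-module and `ℬ` is the associated
tilting class, then every acyclic complex with components in `ℬ` has all its cycles
in `ℬ` (`exℬ = ℬ~`).  Right `R`-modules are modules over `Rᵐᵒᵖ`. -/
theorem stmt5 (R : Type u) [Ring R] [HasExt.{w} (ModuleCat.{u} Rᵐᵒᵖ)]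
    (n : ℕ) (T : ModuleCat.{u} Rᵐᵒᵖ)
    -- `T` has projective dimension at most `n`:
    (hpd : ∀ (N : ModuleCat.{u} Rᵐᵒᵖ) (i : ℕ), n < i → Subsingleton (Abelian.Ext.{w} T N i))
    -- `Ext^i(T, T^{(λ)}) = 0` for every cardinal `λ` and every `i ≥ 1`:
    (hsums : ∀ (ι : Type u) (c : Cofan fun _ : ι => T), IsColimit c →
      ∀ i : ℕ, 1 ≤ i → Subsingleton (Abelian.Ext.{w} T c.pt i))
    -- there is an exact sequence `0 → R → T_0 → ⋯ → T_r → 0` with each `T_j ∈ Add T`: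
    (hcores : ∃ (r : ℕ) (T' : Fin (r + 1) → ModuleCat.{u} Rᵐᵒᵖ)
      (K : Fin (r + 2) → ModuleCat.{u} Rᵐᵒᵖ),
      (∀ j, IsAddMember T (T' j)) ∧
      Nonempty (K 0 ≅ ModuleCat.of Rᵐᵒᵖ R) ∧ IsZero (K (Fin.last (r + 1))) ∧
      ∀ j : Fin (r + 1), IsShortExactSeq (K j.castSucc) (T' j) (K j.succ))
    -- `ℬ` is the associated `n`-tilting class:
    (ℬ : Set (ModuleCat.{u} Rᵐᵒᵖ))
    (hB : ∀ M : ModuleCat.{u} Rᵐᵒᵖ,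
      M ∈ ℬ ↔ ∀ i : ℕ, 1 ≤ i → Subsingleton (Abelian.Ext.{w} T M i))
    (Y : CochainComplex (ModuleCat.{u} Rᵐᵒᵖ) ℤ)
    (hac : ∀ m : ℤ, Y.ExactAt m) (hcomp : ∀ m : ℤ, Y.X m ∈ ℬ) :
    ∀ m : ℤ, Y.cycles m ∈ ℬ := by
  intro m
  rw [hB]
  exact Y.subsingleton_ext_cycles T n hpd hac (fun m => (hB _).1 (hcomp m)) m
end

section
/- Let (𝒜, ℬ) be a complete hereditary cotorsion pair in a Grothendieck category G. Then the following are equivalent: (i) every acyclic unbounded cochain complex with all components in 𝒜 has all its cycle objects in 𝒜 (ex𝒜 = 𝒜~); (ii) for every cochain complex X with all components in 𝒜 and every acyclic cochain complex Y with all components and all cycle objects in ℬ, every chain map X → Y is null-homotopic (dw𝒜 = dg𝒜). -/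
open CategoryTheory CategoryTheory.Limits CategoryTheory.Abelian ZeroObject

universe w' w v u

variable {C : Type u} [Category.{v} C] [Abelian C]

section ExtVanishing

variable [HasExt.{w} C] {S : ShortComplex C} (hS : S.ShortExact)
include hS

lemma exists_lift_of_subsingleton_ext {A : C} (h : Subsingleton (Abelian.Ext.{w} A S.X₁ 1))
    (f : A ⟶ S.X₃) : ∃ g : A ⟶ S.X₂, g ≫ S.g = f := by
  obtain ⟨x, hx⟩ := Abelian.Ext.covariant_sequence_exact₃ A hS (Abelian.Ext.mk₀ f) (zero_add 1)
    (Subsingleton.elim _ _)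
  obtain ⟨g, rfl⟩ := Abelian.Ext.addEquiv₀.symm.surjective x
  exact ⟨g, (Abelian.Ext.mk₀_bijective _ _).1 (by simpa using hx)⟩

lemma exists_extension_of_subsingleton_ext {B : C}
    (h : Subsingleton (Abelian.Ext.{w} S.X₃ B 1)) (f : S.X₁ ⟶ B) :
    ∃ g : S.X₂ ⟶ B, S.f ≫ g = f := by
  obtain ⟨x, hx⟩ := Abelian.Ext.contravariant_sequence_exact₁ hS B (Abelian.Ext.mk₀ f)
    (add_zero 1) (Subsingleton.elim _ _)
  obtain ⟨g, rfl⟩ := Abelian.Ext.addEquiv₀.symm.surjective x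
  exact ⟨g, (Abelian.Ext.mk₀_bijective _ _).1 (by simpa using hx)⟩

lemma subsingleton_ext_of_exists_lift {A : C}
    (h₂ : Subsingleton (Abelian.Ext.{w} A S.X₂ 1))
    (h : ∀ f : A ⟶ S.X₃, ∃ g : A ⟶ S.X₂, g ≫ S.g = f) :
    Subsingleton (Abelian.Ext.{w} A S.X₁ 1) := by
  refine subsingleton_of_forall_eq 0 fun x ↦ ?_
  obtain ⟨y, rfl⟩ := Abelian.Ext.covariant_sequence_exact₁ A hS x
    (Subsingleton.elim _ _) (zero_add 1)
  obtain ⟨f, rfl⟩ := Abelian.Ext.addEquiv₀.symm.surjective y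
  obtain ⟨g, rfl⟩ := h f
  simp [← Abelian.Ext.mk₀_comp_mk₀, Abelian.Ext.comp_assoc_of_second_deg_zero]

lemma subsingleton_ext_of_exists_extension {B : C}
    (h₂ : Subsingleton (Abelian.Ext.{w} S.X₂ B 1))
    (h : ∀ f : S.X₁ ⟶ B, ∃ g : S.X₂ ⟶ B, S.f ≫ g = f) :
    Subsingleton (Abelian.Ext.{w} S.X₃ B 1) := by
  refine subsingleton_of_forall_eq 0 fun x ↦ ?_
  obtain ⟨y, rfl⟩ := Abelian.Ext.contravariant_sequence_exact₃ hS B x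
    (Subsingleton.elim _ _) (add_zero 1)
  obtain ⟨f, rfl⟩ := Abelian.Ext.addEquiv₀.symm.surjective y
  obtain ⟨g, rfl⟩ := h f
  simp [← Abelian.Ext.mk₀_comp_mk₀]

lemma subsingleton_ext_middle {A : C} {n : ℕ}
    (h₁ : Subsingleton (Abelian.Ext.{w} A S.X₁ n))
    (h₃ : Subsingleton (Abelian.Ext.{w} A S.X₃ n)) :
    Subsingleton (Abelian.Ext.{w} A S.X₂ n) := by
  refine subsingleton_of_forall_eq 0 fun x ↦ ?_
  obtain ⟨y, rfl⟩ := Abelian.Ext.covariant_sequence_exact₂ A hS x (Subsingleton.elim _ _)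
  simp [Subsingleton.elim y 0]

lemma subsingleton_ext_right {A : C} {n m : ℕ} (hnm : n + 1 = m)
    (h₂ : Subsingleton (Abelian.Ext.{w} A S.X₂ n))
    (h₁ : Subsingleton (Abelian.Ext.{w} A S.X₁ m)) :
    Subsingleton (Abelian.Ext.{w} A S.X₃ n) := by
  refine subsingleton_of_forall_eq 0 fun x ↦ ?_
  obtain ⟨y, rfl⟩ := Abelian.Ext.covariant_sequence_exact₃ A hS x hnm (Subsingleton.elim _ _)
  simp [Subsingleton.elim y 0]

end ExtVanishing

namespace IsCotorsionPair

variable [HasExt.{w} C] {𝒜 ℬ : Set C} (h : IsCotorsionPair.{w} C 𝒜 ℬ)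
include h

lemma ext {A B : C} (hA : A ∈ 𝒜) (hB : B ∈ ℬ) : Subsingleton (Abelian.Ext.{w} A B 1) :=
  (h.mem_left_iff A).1 hA B hB

lemma mem_right_of_injective (I : C) [Injective I] : I ∈ ℬ :=
  (h.mem_right_iff I).2 fun _ _ ↦ subsingleton_of_forall_eq 0
    (Abelian.Ext.eq_zero_of_injective (n := 0))

lemma mem_right_of_isZero {Z : C} (hZ : IsZero Z) : Z ∈ ℬ :=
  have := hZ.injective
  h.mem_right_of_injective Z

lemma mem_right_middle {S : ShortComplex C} (hS : S.ShortExact) (h₁ : S.X₁ ∈ ℬ)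
    (h₃ : S.X₃ ∈ ℬ) : S.X₂ ∈ ℬ :=
  (h.mem_right_iff _).2 fun _ hA ↦ subsingleton_ext_middle hS (h.ext hA h₁) (h.ext hA h₃)

lemma mem_right_of_iso {X Y : C} (e : X ≅ Y) (hX : X ∈ ℬ) : Y ∈ ℬ :=
  h.mem_right_middle (S := ShortComplex.mk e.hom (0 : Y ⟶ 0) (by simp))
    { exact := (ShortComplex.exact_iff_epi _ rfl).2 (by dsimp; infer_instance)
      mono_f := by dsimp; infer_instance
      epi_g := ⟨fun _ _ _ ↦ (isZero_zero C).eq_of_src _ _⟩ } hX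
    (h.mem_right_of_isZero (isZero_zero C))

end IsCotorsionPair

lemma IsCompleteHereditaryCotorsionPair.mem_right_quotient [HasExt.{w} C] {𝒜 ℬ : Set C}
    (h : IsCompleteHereditaryCotorsionPair.{w} C 𝒜 ℬ) {S : ShortComplex C} (hS : S.ShortExact)
    (h₁ : S.X₁ ∈ ℬ) (h₂ : S.X₂ ∈ ℬ) : S.X₃ ∈ ℬ :=
  (h.mem_right_iff _).2 fun A hA ↦ subsingleton_ext_right hS rfl
    (h.ext hA h₂) (h.hereditary A hA _ h₁ 2 (by simp))

namespace HomologicalComplex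

/-- The sequence `Zⁿ → Xⁿ → Zⁿ⁺¹` relating the components and the cycles of a cochain complex. -/
noncomputable abbrev cyclesSequence (X : CochainComplex C ℤ) (i j : ℤ) : ShortComplex C :=
  ShortComplex.mk (X.iCycles i) (X.toCycles i j) (by simp [← cancel_mono (X.iCycles j)])

lemma shortExact_cyclesSequence (X : CochainComplex C ℤ) {i j : ℤ} (hij : i + 1 = j)
    (hX : X.ExactAt j) : (X.cyclesSequence i j).ShortExact where
  exact := by
    refine ShortComplex.exact_of_f_is_kernel _ (KernelFork.IsLimit.ofι _ _
      (fun k hk ↦ X.liftCycles k j (by simp [hij]) ?_) (fun k hk ↦ by simp) (fun k hk m hm ↦ ?_))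
    · simpa using hk =≫ X.iCycles j
    · simpa [← cancel_mono (X.iCycles i)] using hm
  mono_f := by dsimp; infer_instance
  epi_g := by
    rw [X.exactAt_iff_exact_up_to_refinements i j (j + 1) (by simp [← hij]) (by simp)] at hX
    dsimp
    rw [epi_iff_surjective_up_to_refinements]
    intro A y
    obtain ⟨A', π, hπ, x, hx⟩ := hX (y ≫ X.iCycles j) (by simp)
    exact ⟨A', π, hπ, x, by simpa [← cancel_mono (X.iCycles j)] using hx⟩

end HomologicalComplex

/-- Every chain map from a complex in `𝒜~` to a complex in `ℬ~` is null-homotopic. -/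
lemma IsCotorsionPair.nonempty_homotopy_zero [HasExt.{w} C] {𝒜 ℬ : Set C}
    (h : IsCotorsionPair.{w} C 𝒜 ℬ) {X Y : CochainComplex C ℤ} (f : X ⟶ Y)
    (hX : ∀ n, X.ExactAt n) (hX𝒜 : ∀ n, X.cycles n ∈ 𝒜)
    (hY : ∀ n, Y.ExactAt n) (hYℬ : ∀ n, Y.X n ∈ ℬ) (hYZ : ∀ n, Y.cycles n ∈ ℬ) :
    Nonempty (Homotopy f 0) := by
  have lift (m n i : ℤ) (hn : m + 1 = n) (g : X.cycles i ⟶ Y.X n) (hg : g ≫ Y.d n (n + 1) = 0) :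
      ∃ t : X.cycles i ⟶ Y.X m, t ≫ Y.d m n = g := by
    obtain ⟨t, ht⟩ := exists_lift_of_subsingleton_ext (Y.shortExact_cyclesSequence hn (hY n))
      (h.ext (hX𝒜 i) (hYZ m)) (Y.liftCycles g (n + 1) (by simp) hg)
    exact ⟨t, by simpa using ht =≫ Y.iCycles n⟩
  have ex (i j m : ℤ) (hj : i + 1 = j) (g : X.cycles i ⟶ Y.X m) :
      ∃ s : X.X i ⟶ Y.X m, X.iCycles i ≫ s = g :=
    exists_extension_of_subsingleton_ext (X.shortExact_cyclesSequence hj (hX j))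
      (h.ext (hX𝒜 j) (hYℬ m)) g
  choose t ht using fun n : ℤ ↦ lift (n - 1) n n (by simp) (X.iCycles n ≫ f.f n) (by simp)
  have key (l m n : ℤ) (hm : l + 1 = m) (hn : m + 1 = n) (tm : X.cycles m ⟶ Y.X l)
      (htm : tm ≫ Y.d l m = X.iCycles m ≫ f.f m) (tn : X.cycles n ⟶ Y.X m)
      (htn : tn ≫ Y.d m n = X.iCycles n ≫ f.f n) :
      ∃ s : X.X m ⟶ Y.X l, X.iCycles m ≫ s = tm ∧
        f.f m = X.toCycles m n ≫ tn + s ≫ Y.d l m := by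
    obtain ⟨s, hs⟩ := ex m n l hn tm
    have hS := X.shortExact_cyclesSequence hn (hX n)
    have := hS.epi_g
    obtain ⟨k, hk⟩ : ∃ k : X.cycles n ⟶ Y.X m,
        X.toCycles m n ≫ k = f.f m - s ≫ Y.d l m :=
      ⟨hS.exact.desc _ (by simp [reassoc_of% hs, htm]), hS.exact.g_desc _ _⟩
    obtain ⟨c, hc⟩ := lift l m n hm (k - tn) (by
      subst hn
      rw [← cancel_epi (X.toCycles m (m + 1))]
      simp [reassoc_of% hk, htn])
    refine ⟨s + X.toCycles m n ≫ c, ?_, ?_⟩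
    · have := (X.cyclesSequence m n).zero
      dsimp at this
      simp [hs, reassoc_of% this]
    · rw [Preadditive.add_comp, Category.assoc, hc, Preadditive.comp_sub, hk]
      abel
  choose s hs hs' using fun n : ℤ ↦ key (n - 1) n (n + 1) (by simp) rfl (t n) (ht n)
    ((t (n + 1)) ≫ (Y.XIsoOfEq (by simp)).hom) (by simp [ht])
  refine ⟨⟨fun i j ↦ if hij : j + 1 = i then s i ≫ (Y.XIsoOfEq (by simp [← hij])).hom else 0,
    fun i j hij ↦ dif_neg hij, fun i ↦ ?_⟩⟩
  rw [dNext_eq _ (i' := i + 1) (by simp), prevD_eq _ (j' := i - 1) (by simp),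
    dif_pos rfl, dif_pos (by simp), hs' i]
  simp [← hs]

section KillCycles

variable (E : CochainComplex C ℤ) {A : ℤ → C} (p : ∀ n, A n ⟶ E.cycles n)

/-- The mapping cone of the chain map to `E` from the complex with components `A n` and zero
differential that is induced by morphisms `A n ⟶ E.cycles n`. -/
noncomputable def killCycles : CochainComplex C ℤ :=
  CochainComplex.of (fun n ↦ E.X n ⊞ A (n + 1))
    (fun n ↦ biprod.desc (E.d n (n + 1)) (p (n + 1) ≫ E.iCycles (n + 1)) ≫ biprod.inl)
    (fun n ↦ by ext <;> simp)

namespace killCycles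

/-- The inclusion of the first summand of `(killCycles E p).X n`. -/
noncomputable def inl (n : ℤ) : E.X n ⟶ (killCycles E p).X n :=
  (biprod.inl : _ ⟶ E.X n ⊞ A (n + 1))

/-- The inclusion of the second summand of `(killCycles E p).X n`. -/
noncomputable def inr (n : ℤ) : A (n + 1) ⟶ (killCycles E p).X n :=
  (biprod.inr : _ ⟶ E.X n ⊞ A (n + 1))

variable {E p} in
lemma hom_ext {n : ℤ} {M : C} {f g : (killCycles E p).X n ⟶ M}
    (h₁ : inl E p n ≫ f = inl E p n ≫ g) (h₂ : inr E p n ≫ f = inr E p n ≫ g) : f = g :=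
  biprod.hom_ext' (X := E.X n) (Y := A (n + 1)) f g h₁ h₂

/-- Constructor for morphisms from `(killCycles E p).X n`. -/
noncomputable def desc {n : ℤ} {M : C} (f : E.X n ⟶ M) (g : A (n + 1) ⟶ M) :
    (killCycles E p).X n ⟶ M :=
  (biprod.desc f g : E.X n ⊞ A (n + 1) ⟶ M)

@[simp]
lemma inl_desc {n : ℤ} {M : C} (f : E.X n ⟶ M) (g : A (n + 1) ⟶ M) :
    inl E p n ≫ desc E p f g = f :=
  biprod.inl_desc _ _

@[simp]
lemma inr_desc {n : ℤ} {M : C} (f : E.X n ⟶ M) (g : A (n + 1) ⟶ M) :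
    inr E p n ≫ desc E p f g = g :=
  biprod.inr_desc _ _

lemma d_eq (n : ℤ) : (killCycles E p).d n (n + 1) =
    desc E p (E.d n (n + 1)) (p (n + 1) ≫ E.iCycles (n + 1)) ≫ inl E p (n + 1) :=
  CochainComplex.of_d (fun n ↦ E.X n ⊞ A (n + 1))
    (fun n ↦ biprod.desc (E.d n (n + 1)) (p (n + 1) ≫ E.iCycles (n + 1)) ≫ biprod.inl) n

@[simp]
lemma inl_d (n : ℤ) : inl E p n ≫ (killCycles E p).d n (n + 1) =
    E.d n (n + 1) ≫ inl E p (n + 1) := by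
  rw [d_eq, ← Category.assoc, inl_desc]

@[simp]
lemma inr_d (n : ℤ) : inr E p n ≫ (killCycles E p).d n (n + 1) =
    p (n + 1) ≫ E.iCycles (n + 1) ≫ inl E p (n + 1) := by
  rw [d_eq, ← Category.assoc, inr_desc, Category.assoc]

end killCycles

open killCycles

/-- The inclusion of a complex `E` in `killCycles E p`. -/
noncomputable def toKillCycles : E ⟶ killCycles E p where
  f := inl E p
  comm' i j hij := by
    obtain rfl : i + 1 = j := hij
    exact inl_d E p i

@[simp]
lemma toKillCycles_f (n : ℤ) : (toKillCycles E p).f n = inl E p n := rfl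

lemma hasLiftingProperty_toKillCycles_f (n : ℤ) {M N : C} (q : M ⟶ N)
    (hq : ∀ f : A (n + 1) ⟶ N, ∃ g, g ≫ q = f) :
    HasLiftingProperty ((toKillCycles E p).f n) q where
  sq_hasLift {f g} sq := by
    obtain ⟨t, ht⟩ := hq (inr E p n ≫ g)
    have hw := sq.w
    rw [toKillCycles_f] at hw
    exact ⟨⟨{
      l := desc E p f t
      fac_left := inl_desc E p f t
      fac_right := hom_ext (by rw [← Category.assoc, inl_desc, hw])
        (by rw [← Category.assoc, inr_desc, ht]) }⟩⟩

lemma exists_toKillCycles_comp_eq {Y : CochainComplex C ℤ} (f : E ⟶ Y)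
    (hY : ∀ (n : ℤ) (g : A (n + 1) ⟶ Y.cycles (n + 1)),
      ∃ t : A (n + 1) ⟶ Y.X n, t ≫ Y.toCycles n (n + 1) = g) :
    ∃ g : killCycles E p ⟶ Y, toKillCycles E p ≫ g = f := by
  choose t ht using fun n ↦ hY n (p (n + 1) ≫ HomologicalComplex.cyclesMap f (n + 1))
  have ht' (n : ℤ) : t n ≫ Y.d n (n + 1) = p (n + 1) ≫ E.iCycles (n + 1) ≫ f.f (n + 1) := by
    simpa using ht n =≫ Y.iCycles (n + 1)
  refine ⟨{
    f := fun n ↦ desc E p (f.f n) (t n)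
    comm' := ?_ }, ?_⟩
  · intro i j hij
    obtain rfl : i + 1 = j := hij
    apply hom_ext <;> simp only [← Category.assoc, inl_desc, inr_desc, inl_d, inr_d] <;> simp [ht']
  · ext n
    exact inl_desc E p _ _

end KillCycles

section Sequence

/-- A sequential colimit of complexes along maps sending cycles to boundaries up to refinements
is acyclic. -/
lemma exactAt_of_isColimit_of_cycles_up_to_refinements [HasColimitsOfShape ℕ C]
    [HasExactColimitsOfShape ℕ C] {F : ℕ ⥤ CochainComplex C ℤ}
    {c : Cocone F} (hc : IsColimit c) (n : ℤ)
    (h : ∀ k, ∃ (T : C) (π : T ⟶ (F.obj k).cycles (n + 1)) (_ : Epi π)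
      (y : T ⟶ (F.obj (k + 1)).X n),
      π ≫ (F.obj k).iCycles (n + 1) ≫ (F.map (homOfLE (Nat.le_add_right k 1))).f (n + 1) =
        y ≫ (F.obj (k + 1)).d n (n + 1)) :
    c.pt.ExactAt (n + 1) := by
  let ι (k : ℕ) : F.obj k ⟶ c.pt := c.ι.app k
  have h₀ (k : ℕ) :
      (F.obj k).iCycles (n + 1) ≫ (ι k).f (n + 1) ≫ cokernel.π (c.pt.d n (n + 1)) = 0 := by
    obtain ⟨T, π, _, y, hy⟩ := h k
    have hι : F.map (homOfLE (Nat.le_add_right k 1)) ≫ ι (k + 1) = ι k := c.w _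
    rw [← cancel_epi π, ← hι, HomologicalComplex.comp_f, Category.assoc, reassoc_of% hy,
      comp_zero, ← (ι (k + 1)).comm_assoc, cokernel.condition, comp_zero, comp_zero]
  let ev (m : ℤ) := HomologicalComplex.eval C (ComplexShape.up ℤ) m
  let δ : F ⋙ ev (n + 1) ⟶ F ⋙ ev (n + 1 + 1) := {
    app k := (F.obj k).d _ _
    naturality _ _ φ := (F.map φ).comm _ _ }
  let κ (k : ℕ) : (kernel δ).obj k ⟶ (F.obj k).X (n + 1) := (kernel.ι δ).app k
  have hκ (k : ℕ) : κ k ≫ (ι k).f (n + 1) ≫ cokernel.π (c.pt.d n (n + 1)) = 0 := by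
    have hz : κ k ≫ (F.obj k).d (n + 1) (n + 1 + 1) = 0 := congr_app (kernel.condition δ) k
    rw [← (F.obj k).liftCycles_i (κ k) (n + 1 + 1) (by simp) hz, Category.assoc, h₀, comp_zero]
  let f : colimit (kernel δ) ⟶ c.pt.X (n + 1) := (colimit.isColimit (kernel δ)).desc
    ((Cocone.precompose (kernel.ι δ)).obj ((ev (n + 1)).mapCocone c))
  have hf (k : ℕ) : colimit.ι (kernel δ) k ≫ f = κ k ≫ (ι k).f (n + 1) :=
    (colimit.isColimit (kernel δ)).fac _ k
  have hex := colim.exact_mapShortComplex (ShortComplex.exact_kernel δ)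
    (colimit.isColimit (kernel δ))
    (c₂ := (ev (n + 1)).mapCocone c) (isColimitOfPreserves (ev (n + 1)) hc)
    (c₃ := (ev (n + 1 + 1)).mapCocone c) (isColimitOfPreserves (ev (n + 1 + 1)) hc)
    f (c.pt.d (n + 1) (n + 1 + 1)) hf (fun k ↦ (c.ι.app k).comm _ _)
  have hfd : f ≫ cokernel.π (c.pt.d n (n + 1)) = 0 :=
    colimit.hom_ext fun k ↦ by rw [reassoc_of% hf, hκ, comp_zero]
  rw [c.pt.exactAt_iff_exact_up_to_refinements n (n + 1) (n + 1 + 1) (by simp) (by simp)]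
  intro B x hx
  have hx0 : x ≫ cokernel.π (c.pt.d n (n + 1)) = 0 := by
    rw [ShortComplex.exact_iff_exact_up_to_refinements] at hex
    obtain ⟨B', π, _, z, hz⟩ : ∃ (B' : C) (π : B' ⟶ B) (_ : Epi π)
        (z : B' ⟶ colimit (kernel δ)), π ≫ x = z ≫ f := hex x hx
    rw [← cancel_epi π, comp_zero, reassoc_of% hz, hfd, comp_zero]
  exact (ShortComplex.exact_iff_exact_up_to_refinements _).1
    (ShortComplex.exact_cokernel (c.pt.d n (n + 1))) x hx0

/-- The canonical map from the first term to a sequential colimit has the left lifting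
property with respect to `q` if all transition maps have. -/
lemma hasLiftingProperty_ι_app_zero {D : Type*} [Category* D] {F : ℕ ⥤ D} {c : Cocone F}
    (hc : IsColimit c) {M N : D} (q : M ⟶ N)
    (h : ∀ k, HasLiftingProperty (F.map (homOfLE (Nat.le_add_right k 1))) q) :
    HasLiftingProperty (c.ι.app 0) q :=
  HasLiftingProperty.transfiniteComposition.hasLiftingProperty_ι_app_bot hc fun k _ ↦ h k

end Sequence

section Approximation

variable [HasExt.{w} C] {𝒜 ℬ : Set C}

lemma IsCompleteCotorsionPair.exists_epi (h : IsCompleteCotorsionPair.{w} C 𝒜 ℬ) (M : C) :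
    ∃ (A : C) (p : A ⟶ M), A ∈ 𝒜 ∧ Epi p := by
  obtain ⟨_, A, _, hA, _, p, _, hS⟩ := h.precover M
  exact ⟨A, p, hA, hS.epi_g⟩

/-- Every complex embeds in a complex in which its cycles become boundaries, via a map
with lifting properties determined by the left class of the cotorsion pair. -/
lemma IsCompleteCotorsionPair.exists_killing_cycles (h : IsCompleteCotorsionPair.{w} C 𝒜 ℬ)
    (E : CochainComplex C ℤ) :
    ∃ (E' : CochainComplex C ℤ) (i : E ⟶ E'),
      (∀ (n : ℤ) {M N : C} (q : M ⟶ N), (∀ A ∈ 𝒜, ∀ f : A ⟶ N, ∃ g, g ≫ q = f) →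
        HasLiftingProperty (i.f n) q) ∧
      (∀ Y : CochainComplex C ℤ, (∀ n, Y.ExactAt n) → (∀ n, Y.cycles n ∈ ℬ) →
        ∀ f : E ⟶ Y, ∃ g : E' ⟶ Y, i ≫ g = f) ∧
      (∀ n : ℤ, ∃ (T : C) (π : T ⟶ E.cycles (n + 1)) (_ : Epi π) (y : T ⟶ E'.X n),
        π ≫ E.iCycles (n + 1) ≫ i.f (n + 1) = y ≫ E'.d n (n + 1)) := by
  choose A p hA hp using fun n ↦ h.exists_epi (E.cycles n)
  exact ⟨killCycles E p, toKillCycles E p,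
    fun n _ _ q hq ↦ hasLiftingProperty_toKillCycles_f E p n q (hq _ (hA _)),
    fun Y hY hYℬ f ↦ exists_toKillCycles_comp_eq E p f fun n g ↦
      exists_lift_of_subsingleton_ext (Y.shortExact_cyclesSequence rfl (hY _))
        (h.ext (hA _) (hYℬ n)) g,
    fun n ↦ ⟨_, p (n + 1), hp _, killCycles.inr E p n, (killCycles.inr_d E p n).symm⟩⟩

/-- Every complex maps to an acyclic complex, via a map with lifting properties determined
by the left class of the cotorsion pair. -/
lemma IsCompleteCotorsionPair.exists_acyclic [HasColimitsOfShape ℕ C]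
    [HasExactColimitsOfShape ℕ C] (h : IsCompleteCotorsionPair.{w} C 𝒜 ℬ)
    (E : CochainComplex C ℤ) :
    ∃ (E' : CochainComplex C ℤ) (i : E ⟶ E'),
      (∀ n, E'.ExactAt n) ∧
      (∀ (n : ℤ) {M N : C} (q : M ⟶ N), (∀ A ∈ 𝒜, ∀ f : A ⟶ N, ∃ g, g ≫ q = f) →
        HasLiftingProperty (i.f n) q) ∧
      (∀ Y : CochainComplex C ℤ, (∀ n, Y.ExactAt n) → (∀ n, Y.cycles n ∈ ℬ) →
        ∀ f : E ⟶ Y, ∃ g : E' ⟶ Y, i ≫ g = f) := by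
  choose next i hi₁ hi₂ hi₃ using h.exists_killing_cycles
  let X (k : ℕ) : CochainComplex C ℤ := Nat.rec E (fun _ E ↦ next E) k
  let F := Functor.ofSequence (X := X) (fun k ↦ i (X k))
  have hF (k : ℕ) : F.map (homOfLE (Nat.le_add_right k 1)) = i (F.obj k) :=
    Functor.ofSequence_map_homOfLE_succ _ k
  let c := colimit.cocone F
  have hc : IsColimit c := colimit.isColimit F
  refine ⟨c.pt, c.ι.app 0, fun n ↦ ?_, fun n M N q hq ↦ ?_, fun Y hY hYℬ f ↦ ?_⟩
  · obtain ⟨n, rfl⟩ : ∃ m, n = m + 1 := ⟨n - 1, by simp⟩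
    refine exactAt_of_isColimit_of_cycles_up_to_refinements hc n fun k ↦ ?_
    rw [hF]
    exact hi₃ (F.obj k) n
  · refine hasLiftingProperty_ι_app_zero
      (isColimitOfPreserves (HomologicalComplex.eval C (ComplexShape.up ℤ) n) hc) q fun k ↦ ?_
    dsimp only [Functor.comp_map]
    rw [hF]
    exact hi₁ (F.obj k) n q hq
  · have : HasLiftingProperty (c.ι.app 0) (0 : Y ⟶ 0) :=
      hasLiftingProperty_ι_app_zero hc _ fun k ↦ by
        rw [hF]
        exact ⟨fun {f g} _ ↦ by
          obtain ⟨l, hl⟩ := hi₂ (F.obj k) Y hY hYℬ f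
          exact ⟨⟨{ l := l, fac_left := hl, fac_right := (isZero_zero _).eq_of_tgt _ _ }⟩⟩⟩
    have sq : CommSq f (c.ι.app 0) (0 : Y ⟶ 0) 0 := ⟨(isZero_zero _).eq_of_tgt _ _⟩
    obtain ⟨⟨l⟩⟩ := this.sq_hasLift sq
    exact ⟨l.l, l.fac_left⟩

lemma IsCotorsionPair.mem_left_of_hasLiftingProperty [EnoughInjectives C]
    (h : IsCotorsionPair.{w} C 𝒜 ℬ) {X Y : C} (hX : X ∈ 𝒜) (i : X ⟶ Y)
    (hi : ∀ {M N : C} (q : M ⟶ N), (∀ A ∈ 𝒜, ∀ f : A ⟶ N, ∃ g, g ≫ q = f) →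
      HasLiftingProperty i q) : Y ∈ 𝒜 := by
  refine (h.mem_left_iff Y).2 fun B hB ↦ ?_
  let S := ShortComplex.mk (Injective.ι B) (cokernel.π _) (cokernel.condition _)
  have hS : S.ShortExact := { exact := ShortComplex.exact_cokernel _ }
  have lift (A : C) (hA : A ∈ 𝒜) (f : A ⟶ S.X₃) : ∃ g, g ≫ S.g = f :=
    exists_lift_of_subsingleton_ext hS (h.ext hA hB) f
  refine subsingleton_ext_of_exists_lift hS (subsingleton_of_forall_eq 0
    (Abelian.Ext.eq_zero_of_injective (n := 0))) fun f ↦ ?_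
  obtain ⟨g, hg⟩ := lift X hX (i ≫ f)
  have := hi S.g lift
  have sq : CommSq g i S.g f := ⟨hg⟩
  exact ⟨sq.lift, sq.fac_right⟩

end Approximation

/-- If all complexes in `ex𝒜` are in `𝒜~`, then all complexes in `dw𝒜` are in `dg𝒜`. -/
lemma IsCompleteCotorsionPair.nonempty_homotopy_zero_of_cycles_mem
    [HasColimitsOfShape ℕ C] [HasExactColimitsOfShape ℕ C] [EnoughInjectives C]
    [HasExt.{w} C] {𝒜 ℬ : Set C} (h : IsCompleteCotorsionPair.{w} C 𝒜 ℬ)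
    (h𝒜 : ∀ X : CochainComplex C ℤ, (∀ n, X.ExactAt n) → (∀ n, X.X n ∈ 𝒜) →
      ∀ n, X.cycles n ∈ 𝒜)
    {X Y : CochainComplex C ℤ} (hX : ∀ n, X.X n ∈ 𝒜) (hY : ∀ n, Y.ExactAt n)
    (hYℬ : ∀ n, Y.X n ∈ ℬ) (hYZ : ∀ n, Y.cycles n ∈ ℬ) (f : X ⟶ Y) :
    Nonempty (Homotopy f 0) := by
  obtain ⟨E, i, hE, hi, hiY⟩ := h.exists_acyclic X
  obtain ⟨g, rfl⟩ := hiY Y hY hYZ f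
  obtain ⟨H⟩ := h.nonempty_homotopy_zero g hE
    (h𝒜 E hE fun n ↦ h.mem_left_of_hasLiftingProperty (hX n) (i.f n) (hi n)) hY hYℬ hYZ
  exact ⟨(H.compLeft i).trans (.ofEq comp_zero)⟩

section AugmentedResolution

open ComplexShape

/-- Any object is the degree zero component of an exact complex whose components in positive
degrees are injective. -/
lemma exists_exact_complex_of_injective [EnoughInjectives C] (B : C) :
    ∃ L : CochainComplex C ℕ, L.X 0 = B ∧ (∀ n, L.ExactAt n) ∧ ∀ n, Injective (L.X (n + 1)) := by
  let R := injectiveResolution B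
  let L := CochainComplex.augment R.cocomplex (R.ι.f 0 : B ⟶ _) R.ι_f_zero_comp_complex_d
  refine ⟨L, rfl, fun n ↦ ?_, fun n ↦ R.injective n⟩
  match n with
  | 0 =>
    rw [L.exactAt_iff' 0 0 1 (by simp) (by simp)]
    exact (ShortComplex.exact_iff_mono _ (L.shape 0 0 (by simp))).2
      (inferInstanceAs (Mono (R.ι.f 0)))
  | 1 =>
    rw [L.exactAt_iff' 0 1 2 (by simp) (by simp)]
    exact R.exact₀
  | n + 2 =>
    rw [L.exactAt_iff' (n + 1) (n + 2) (n + 3) (by simp) (by simp)]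
    exact R.exact_succ n

/-- A morphism to the first component of an augmented injective resolution that vanishes on
boundaries extends to a chain map from any acyclic complex. -/
lemma exists_hom_extend {X : CochainComplex C ℤ} (hX : ∀ n, X.ExactAt n)
    (L : CochainComplex C ℕ) [∀ n, Injective (L.X (n + 1))] (m : ℤ) {i j : ℤ} (hij : i + 1 = j)
    (hj : (embeddingUpIntGE m).f 0 = j) (φ : X.X j ⟶ L.X 0) (hφ : X.d i j ≫ φ = 0) :
    ∃ f : X ⟶ L.extend (embeddingUpIntGE m),
      f.f j = φ ≫ (L.extendXIso (embeddingUpIntGE m) hj).inv := by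
  let e := embeddingUpIntGE m
  have he (n : ℕ) : e.f n + 1 = e.f (n + 1) := by simp [e, add_assoc]
  have extend {i j k : ℤ} (hij : i + 1 = j) (hjk : j + 1 = k) {J : C} [Injective J]
      (f : X.X j ⟶ J) (hf : X.d i j ≫ f = 0) : ∃ g, f = X.d j k ≫ g :=
    have h := (X.exactAt_iff' i j k (by simp [← hij]) (by simp [← hjk])).1 (hX j)
    ⟨h.descToInjective f hf, (h.comp_descToInjective f hf).symm⟩
  subst hj
  obtain ⟨one, h_one⟩ := extend hij (he 0) (φ ≫ L.d 0 1) (by rw [reassoc_of% hφ, zero_comp])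
  have succ (n : ℕ) (f : X.X (e.f n) ⟶ L.X n) (g : X.X (e.f (n + 1)) ⟶ L.X (n + 1))
      (h : f ≫ L.d n (n + 1) = X.d (e.f n) (e.f (n + 1)) ≫ g) :
      ∃ g', g ≫ L.d (n + 1) (n + 2) = X.d (e.f (n + 1)) (e.f (n + 2)) ≫ g' :=
    extend (he n) (he (n + 1)) _ (by rw [← reassoc_of% h, L.d_comp_d, comp_zero])
  let ψ : X.restriction e ⟶ L := CochainComplex.mkHom _ _ φ one h_one
    fun n p ↦ ⟨_, (succ n p.1 p.2.1 p.2.2).choose_spec⟩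
  have hψ : e.HasLift ψ := by
    intro k hk i' hi'
    rw [boundaryGE_embeddingUpIntGE_iff] at hk
    subst hk
    obtain rfl : i = i' := add_right_cancel (hij.trans hi'.symm)
    exact hφ
  exact ⟨e.liftExtend ψ hψ, (e.liftExtend_f ψ hψ rfl).trans (Category.id_comp _)⟩

end AugmentedResolution

/-- A bounded below exact complex with components in the right class of a hereditary cotorsion
pair has its cycles in that class. -/
lemma IsCompleteHereditaryCotorsionPair.cycles_mem [HasExt.{w} C] {𝒜 ℬ : Set C}
    (h : IsCompleteHereditaryCotorsionPair.{w} C 𝒜 ℬ) {Y : CochainComplex C ℤ}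
    (hY : ∀ n, Y.ExactAt n) (hYℬ : ∀ n, Y.X n ∈ ℬ) (m : ℤ) (hm : ∀ n < m, IsZero (Y.X n))
    (n : ℤ) : Y.cycles n ∈ ℬ := by
  have h₀ (n : ℤ) (hn : n < m) : Y.cycles n ∈ ℬ :=
    h.mem_right_of_isZero ((hm n hn).of_mono (Y.iCycles n))
  obtain hn | hn := lt_or_ge n m
  · exact h₀ n hn
  · obtain ⟨k, rfl⟩ := Int.le.dest hn
    clear hn
    induction k with
    | zero =>
      exact h.mem_right_quotient (Y.shortExact_cyclesSequence (i := m - 1) (by simp) (hY _))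
        (h₀ _ (by simp)) (hYℬ _)
    | succ k hk =>
      exact h.mem_right_quotient
        (Y.shortExact_cyclesSequence (i := m + k) (by simp [add_assoc]) (hY _)) hk (hYℬ _)

/-- If all complexes in `dw𝒜` are in `dg𝒜`, then all complexes in `ex𝒜` are in `𝒜~`. -/
lemma IsCompleteHereditaryCotorsionPair.cycles_mem_of_nonempty_homotopy_zero
    [EnoughInjectives C] [HasExt.{w} C] {𝒜 ℬ : Set C}
    (h : IsCompleteHereditaryCotorsionPair.{w} C 𝒜 ℬ)
    {X : CochainComplex C ℤ} (hX : ∀ n, X.ExactAt n) (hX𝒜 : ∀ n, X.X n ∈ 𝒜)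
    (hdg : ∀ Y : CochainComplex C ℤ, (∀ n, Y.ExactAt n) → (∀ n, Y.X n ∈ ℬ) →
      (∀ n, Y.cycles n ∈ ℬ) → ∀ f : X ⟶ Y, Nonempty (Homotopy f 0)) (n : ℤ) :
    X.cycles n ∈ 𝒜 := by
  refine (h.mem_left_iff _).2 fun B hB ↦ ?_
  obtain ⟨m, rfl⟩ : ∃ m, n = m + 1 + 1 := ⟨n - 1 - 1, by simp⟩
  have hS := X.shortExact_cyclesSequence (i := m + 1) rfl (hX (m + 1 + 1))
  have := (X.shortExact_cyclesSequence (i := m) rfl (hX (m + 1))).epi_g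
  refine subsingleton_ext_of_exists_extension hS (h.ext (hX𝒜 _) hB) fun g ↦ ?_
  obtain ⟨L, rfl, hL, _⟩ := exists_exact_complex_of_injective B
  let e := ComplexShape.embeddingUpIntGE m
  have h₀ : e.f 0 = m := by simp [e]
  have hz (i : ℤ) (hi : ∀ k, e.f k ≠ i) : IsZero ((L.extend e).X i) := L.isZero_extend_X e i hi
  obtain ⟨f, hf⟩ := exists_hom_extend hX L m (i := m - 1) (by simp) h₀
    (X.toCycles m (m + 1) ≫ g) (by simp)
  have hex (i : ℤ) : (L.extend e).ExactAt i := by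
    by_cases hi : ∃ k, e.f k = i
    · obtain ⟨k, hk⟩ := hi
      exact (L.extend_exactAt_iff e hk).2 (hL k)
    · exact L.extend_exactAt e i (by simpa using hi)
  have hmem (i : ℤ) : (L.extend e).X i ∈ ℬ := by
    by_cases hi : ∃ k, e.f k = i
    · obtain ⟨k, hk⟩ := hi
      refine h.mem_right_of_iso (L.extendXIso e hk).symm ?_
      cases k with
      | zero => exact hB
      | succ k => exact h.mem_right_of_injective _
    · exact h.mem_right_of_isZero (hz i (by simpa using hi))
  have hlt (i : ℤ) (hi : i < m) : IsZero ((L.extend e).X i) :=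
    hz i ((ComplexShape.notMem_range_embeddingUpIntGE_iff m i).2 hi)
  obtain ⟨H⟩ := hdg _ hex hmem (h.cycles_mem hex hmem m hlt) f
  have hH := H.comm m
  rw [dNext_eq _ (i' := m + 1) (by simp), prevD_eq _ (j' := m - 1) (by simp),
    (hlt (m - 1) (by simp)).eq_of_tgt (H.hom m (m - 1)) 0, hf] at hH
  refine ⟨H.hom (m + 1) m ≫ (L.extendXIso e h₀).hom, ?_⟩
  dsimp
  rw [← cancel_epi (X.toCycles m (m + 1)), X.toCycles_i_assoc]
  simpa [e] using (hH =≫ (L.extendXIso e h₀).hom).symm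

/-- for a complete hereditary cotorsion pair `(𝒜, ℬ)` in a Grothendieck category,
`ex𝒜 = 𝒜~` if and only if `dw𝒜 = dg𝒜`. -/
theorem stmt8 (C : Type u) [Category.{v} C] [Abelian C]
    [HasFilteredColimits C] [AB5 C] [HasSeparator C]
    [HasExt.{w} C]
    (𝒜 ℬ : Set C) (hcp : IsCompleteHereditaryCotorsionPair C 𝒜 ℬ) :
    -- (i) every acyclic complex with components in `𝒜` has all its cycles in `𝒜` ...
    (∀ X : CochainComplex C ℤ,
      (∀ n : ℤ, X.ExactAt n) → (∀ n : ℤ, X.X n ∈ 𝒜) → ∀ n : ℤ, X.cycles n ∈ 𝒜) ↔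
    -- ... iff (ii) every chain map from a complex in `dw𝒜` to a complex in `ℬ~`
    -- is null-homotopic:
    (∀ X : CochainComplex C ℤ, (∀ n : ℤ, X.X n ∈ 𝒜) →
      ∀ Y : CochainComplex C ℤ, (∀ n : ℤ, Y.ExactAt n) → (∀ n : ℤ, Y.X n ∈ ℬ) →
        (∀ n : ℤ, Y.cycles n ∈ ℬ) → ∀ f : X ⟶ Y, Nonempty (Homotopy f 0)) := by
  have : HasFilteredColimitsOfSize.{0, 0} C := hasFilteredColimitsOfSize_of_univLE.{0, 0, v, v}
  have : AB5OfSize.{0, 0} C := AB5OfSize_of_univLE.{0, 0, v, v} C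
  have : IsGrothendieckAbelian.{v} C := {}
  exact ⟨fun h X hX Y hY hYℬ hYZ f ↦
      hcp.nonempty_homotopy_zero_of_cycles_mem h hX hY hYℬ hYZ f,
    fun h X hX hX𝒜 n ↦ hcp.cycles_mem_of_nonempty_homotopy_zero hX hX𝒜 (h X hX𝒜) n⟩
end
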